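/- arXiv:2110.05191 — 2 statements merged into one kernel-verified Lean document; each statement's English description precedes it below -/
import Mathlib

section
/- Let n ≥ 1 be a natural number and let H : ℕ → ℕ → ℤ satisfy H_r(0) = 1 for all r and H_r(k) = (n - r - k)·H_r(k-1) + 2·(n - 2r - δ(n-1))·H_{r+1}(k-1) whenever k ≥ 1 and r + k ≤ ⌊n/2⌋. Then H_0(⌊n/2⌋) = L(n) · ∏_{j=1}^{⌊n/2⌋}(n - j), where L is the Lucas sequence. -/
/-- The Lucas sequence: `L 0 = 2`, `L 1 = 1`, `L (m+2) = L (m+1) + L m`. -/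
def lucasSeq : ℕ → ℤ
  | 0 => 2
  | 1 => 1
  | m + 2 => lucasSeq (m + 1) + lucasSeq m

open Finset

/-- Closed form of a two-index recurrence in which the first weight depends only on `r + k` and
the second only on `r`. -/
theorem eq_sum_choose_mul_prod_of_recurrence {R : Type*} [CommRing R] (u v : ℕ → R)
    (H : ℕ → ℕ → R) (N : ℕ) (h0 : ∀ r, H r 0 = 1)
    (hrec : ∀ r k, r + k + 1 ≤ N → H r (k + 1) = u (r + k) * H r k + v r * H (r + 1) k)
    (k r : ℕ) (hrk : r + k ≤ N) :
    H r k = ∑ j ∈ range (k + 1), (k.choose j : R) *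
      ((∏ s ∈ Ico (r + j) (r + k), u s) * ∏ i ∈ Ico r (r + j), v i) := by
  induction k generalizing r with
  | zero => simp [h0]
  | succ k ih =>
    rw [hrec r k (by omega), ih r (by omega), ih (r + 1) (by omega),
      Finset.sum_choose_succ_mul (fun j _ =>
        (∏ s ∈ Ico (r + j) (r + (k + 1)), u s) * ∏ i ∈ Ico r (r + j), v i) k,
      mul_sum, mul_sum]
    congr 1
    · refine sum_congr rfl fun j hj => ?_
      have hjk : r + j ≤ r + k := by have := mem_range.1 hj; omega
      rw [← add_assoc, prod_Ico_succ_top hjk]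
      ring
    · refine sum_congr rfl fun j _ => ?_
      rw [prod_eq_prod_Ico_succ_bot (show r < r + (j + 1) by omega),
        show r + 1 + j = r + (j + 1) by ring, show r + 1 + k = r + (k + 1) by ring]
      ring

/-- The coefficients `n / (n - j) * (n - j).choose j` of the Lucas polynomials. -/
def lucasCoeff (n : ℕ) : ℕ → ℕ
  | 0 => 1
  | j + 1 => (n - (j + 1)).choose (j + 1) + (n - (j + 2)).choose j

theorem sub_mul_lucasCoeff (n j : ℕ) (h : 2 * j ≤ n) :
    (n - j) * lucasCoeff n j = n * (n - j).choose j := by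
  cases j with
  | zero => simp [lucasCoeff]
  | succ j =>
    obtain ⟨m, rfl⟩ := Nat.exists_eq_add_of_le h
    have h1 : 2 * (j + 1) + m - (j + 1) = (j + m) + 1 := by omega
    have h2 : 2 * (j + 1) + m - (j + 2) = j + m := by omega
    rw [lucasCoeff, h1, h2]
    have := Nat.add_one_mul_choose_eq (j + m) j
    linear_combination this

theorem lucasCoeff_succ_mul (n j : ℕ) (h : 2 * j + 2 ≤ n) :
    (j + 1) * (n - (j + 1)) * lucasCoeff n (j + 1) =
      (n - 2 * j) * (n - 2 * j - 1) * lucasCoeff n j := by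
  have e1 := sub_mul_lucasCoeff n j (by omega)
  have e2 := sub_mul_lucasCoeff n (j + 1) (by omega)
  obtain ⟨m, rfl⟩ := Nat.exists_eq_add_of_le h
  have h1 : 2 * j + 2 + m - (j + 1) = j + m + 1 := by omega
  have h2 : 2 * j + 2 + m - j = j + m + 1 + 1 := by omega
  have h3 : 2 * j + 2 + m - 2 * j = m + 2 := by omega
  rw [h1] at e2 ⊢
  rw [h2] at e1
  rw [h3, show m + 2 - 1 = m + 1 by omega]
  have c1 := Nat.choose_succ_right_eq (j + m + 1) j
  have c2 := Nat.choose_mul_succ_eq (j + m + 1) j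
  rw [show j + m + 1 - j = m + 1 by omega] at c1
  rw [show j + m + 1 + 1 - j = m + 2 by omega] at c2
  apply Nat.eq_of_mul_eq_mul_left (show 0 < j + m + 1 + 1 by omega)
  zify at *
  linear_combination (j + m + 1 + 1 : ℤ) * (j + 1) * e2 - (m + 2 : ℤ) * (m + 1) * e1
    + (2 * j + 2 + m : ℤ) * (j + m + 2) * c1 + (2 * j + 2 + m : ℤ) * (m + 1) * c2

theorem sum_choose_sub_eq_fib (n : ℕ) :
    ∑ j ∈ range (n / 2 + 1), (n - j).choose j = Nat.fib (n + 1) := by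
  rw [Nat.fib_succ_eq_sum_choose, Nat.sum_antidiagonal_eq_sum_range_succ_mk,
    ← sum_range_reflect (fun j => j.choose (n - j))]
  have hs : range (n / 2 + 1) ⊆ range n.succ := range_subset_range.2 (by omega)
  rw [sum_subset hs fun j _ hj => Nat.choose_eq_zero_of_lt (by simp at hj; omega)]
  refine sum_congr rfl fun j hj => ?_
  have := mem_range.1 hj
  congr 1
  omega

theorem lucasSeq_succ_eq_fib (n : ℕ) :
    lucasSeq (n + 1) = Nat.fib (n + 2) + Nat.fib n := by
  induction n using Nat.twoStepInduction with
  | zero => simp [lucasSeq]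
  | one => simp [lucasSeq, Nat.fib_add_two]
  | more n h1 h2 =>
    rw [lucasSeq, h1, h2]
    simp only [Nat.fib_add_two (n := n + 2), Nat.fib_add_two (n := n)]
    push_cast
    ring

theorem sum_lucasCoeff (n : ℕ) (hn : 1 ≤ n) :
    ∑ j ∈ range (n / 2 + 1), (lucasCoeff n j : ℤ) = lucasSeq n := by
  obtain ⟨m, rfl⟩ := Nat.exists_eq_add_of_le' hn
  rw [lucasSeq_succ_eq_fib, ← sum_choose_sub_eq_fib (m + 1), sum_range_succ',
    sum_range_succ' (fun j => (m + 1 - j).choose j)]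
  simp only [lucasCoeff]
  push_cast
  rw [sum_add_distrib]
  have : ∑ j ∈ range ((m + 1) / 2), (m + 1 - (j + 2)).choose j = Nat.fib m := by
    cases m with
    | zero => simp
    | succ m =>
      rw [← sum_choose_sub_eq_fib, show (m + 1 + 1) / 2 = m / 2 + 1 by omega]
      refine sum_congr rfl fun j _ => ?_
      congr 1
      omega
  rw [← this]
  push_cast
  simp
  ring

theorem choose_mul_prod_eq_lucasCoeff_mul_prod (n : ℕ) (hn : 1 ≤ n) (j : ℕ) (hj : j ≤ n / 2) :
    ((n / 2).choose j : ℤ) * ∏ i ∈ range j, (2 * ((n : ℤ) - 2 * i - ((n - 1) % 2 : ℕ))) =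
      lucasCoeff n j * ∏ s ∈ range j, ((n : ℤ) - (s + 1)) := by
  induction j with
  | zero => simp [lucasCoeff]
  | succ j ih =>
    have ih := ih (by omega)
    have c := Nat.choose_succ_right_eq (n / 2) j
    have t := lucasCoeff_succ_mul n j (by omega)
    rw [prod_range_succ, prod_range_succ]
    apply mul_left_cancel₀ (show ((j : ℤ) + 1) ≠ 0 by positivity)
    zify [show j ≤ n / 2 by omega, show j + 1 ≤ n by omega, show 2 * j ≤ n by omega,
      show 1 ≤ n - 2 * j by omega] at c t
    have w : 2 * (((n / 2 : ℕ) : ℤ) - j) * ((n : ℤ) - 2 * j - ((n - 1) % 2 : ℕ)) =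
        ((n : ℤ) - 2 * j) * (n - 2 * j - 1) := by
      rcases Nat.even_or_odd' n with ⟨m, rfl | rfl⟩
      · rw [show 2 * m / 2 = m by omega, show (2 * m - 1) % 2 = 1 by omega]
        push_cast
        ring
      · rw [show (2 * m + 1) / 2 = m by omega, show (2 * m + 1 - 1) % 2 = 0 by omega]
        push_cast
        ring
    push_cast at c t w ih ⊢
    set P := ∏ i ∈ range j, (2 * ((n : ℤ) - 2 * i - ((n - 1 : ℕ) : ℤ) % 2))
    set Q := ∏ s ∈ range j, ((n : ℤ) - (s + 1))
    linear_combination (2 * ((n : ℤ) - 2 * j - ((n - 1 : ℕ) : ℤ) % 2)) * P * c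
      + ((n / 2).choose j : ℤ) * P * w + ((n : ℤ) - 2 * j) * (n - 2 * j - 1) * ih - Q * t

theorem omega_lucas_representation
    (n : ℕ) (hn : 1 ≤ n)
    (H : ℕ → ℕ → ℤ)
    (hH0 : ∀ r, H r 0 = 1)
    (hH : ∀ r k, 1 ≤ k → r + k ≤ n / 2 →
      H r k = ((n : ℤ) - r - k) * H r (k - 1)
        + 2 * ((n : ℤ) - 2 * r - ((n - 1) % 2 : ℕ)) * H (r + 1) (k - 1)) :
    H 0 (n / 2) = lucasSeq n * ∏ j ∈ Finset.Icc 1 (n / 2), ((n : ℤ) - j) := by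
  rw [eq_sum_choose_mul_prod_of_recurrence (fun s => (n : ℤ) - (s + 1))
    (fun r => 2 * ((n : ℤ) - 2 * r - ((n - 1) % 2 : ℕ))) H (n / 2) hH0 ?_ (n / 2) 0 (by omega)]
  · have hP : ∏ j ∈ Icc 1 (n / 2), ((n : ℤ) - j) = ∏ s ∈ range (n / 2), ((n : ℤ) - (s + 1)) := by
      rw [← Ico_add_one_right_eq_Icc, prod_Ico_eq_prod_range]
      refine prod_congr rfl fun s _ => ?_
      push_cast
      ring
    rw [hP, ← sum_lucasCoeff n hn, sum_mul]
    refine sum_congr rfl fun j hj => ?_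
    have hj : j ≤ n / 2 := Nat.lt_succ_iff.1 (mem_range.1 hj)
    have key := choose_mul_prod_eq_lucasCoeff_mul_prod n hn j hj
    rw [← prod_range_mul_prod_Ico _ hj, ← mul_assoc (lucasCoeff n j : ℤ), ← key]
    simp only [zero_add, ← range_eq_Ico]
    ring
  · intro r k hrk
    rw [hH r (k + 1) (by omega) (by omega), Nat.add_sub_cancel]
    push_cast
    ring
end

section
/- Let n ≥ 1 be a natural number and let G : ℕ → ℕ → ℤ satisfy G_r(0) = 1 for all r and G_r(k) = 5·(n - r - k)·G_r(k-1) - 2·(n - 2r - δ(n-1))·G_{r+1}(k-1) whenever k ≥ 1 and r + k ≤ ⌊n/2⌋. Then G_0(⌊n/2⌋) = F(n) · ∏_{j=1}^{⌊n/2⌋}(n - j) if n is odd, and G_0(⌊n/2⌋) = L(n) · ∏_{j=1}^{⌊n/2⌋}(n - j) if n is even, where F is the Fibonacci sequence and L is the Lucas sequence. -/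
/-- The Fibonacci sequence: `F 0 = 0`, `F 1 = 1`, `F (m+2) = F (m+1) + F m`. -/
def fibSeq : ℕ → ℤ
  | 0 => 0
  | 1 => 1
  | m + 2 => fibSeq (m + 1) + fibSeq m

open Finset Nat

/-- `dicksonCoeff a j` is the absolute value of the coefficient of `x ^ a` in the Dickson polynomial
`D_{a + 2j}(x, 1)`, characterized by `D_n(x + x⁻¹, 1) = x ^ n + x⁻¹ ^ n`. -/
def dicksonCoeff : ℕ → ℕ → ℤ
  | 0, _ => 2
  | _ + 1, 0 => 1
  | a + 1, j + 1 => dicksonCoeff a (j + 1) + dicksonCoeff (a + 1) j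

lemma dicksonCoeff_succ_mul_factorial (a j : ℕ) :
    dicksonCoeff (a + 1) j * (j ! * (a + 1)!) = (a + 1 + 2 * j) * (a + j)! := by
  induction a generalizing j with
  | zero =>
    induction j with
    | zero => simp [dicksonCoeff]
    | succ j ih =>
      simp only [dicksonCoeff, zero_add, Nat.factorial_succ j] at ih ⊢
      push_cast at ih ⊢
      linear_combination (j + 1 : ℤ) * ih
  | succ a iha =>
    induction j with
    | zero =>
      simp [dicksonCoeff, Nat.factorial_succ]
    | succ j ih =>
      have h := iha (j + 1)
      rw [show a + (j + 1) = a + 1 + j by ring] at h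
      rw [dicksonCoeff, show a + 1 + (j + 1) = (a + 1 + j) + 1 by ring,
        Nat.factorial_succ (a + 1 + j)]
      rw [Nat.factorial_succ (a + 1)] at ih ⊢
      rw [Nat.factorial_succ j] at h ⊢
      push_cast at h ih ⊢
      linear_combination (a + 2 : ℤ) * h + (j + 1 : ℤ) * ih

lemma dicksonCoeff_mul_factorial {a j s : ℕ} (h : a + j = s + 1) :
    dicksonCoeff a j * (j ! * a !) = (a + 2 * j) * s ! := by
  cases a with
  | zero =>
    obtain rfl : j = s + 1 := by omega
    simp [dicksonCoeff, Nat.factorial_succ]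
    ring
  | succ a =>
    obtain rfl : s = a + j := by omega
    simpa using dicksonCoeff_succ_mul_factorial a j

/-- The Dickson polynomial `D_{2m + ε}(x, 1)` divided by `x ^ ε`, evaluated at `x = √5`. -/
def dicksonSum (ε m : ℕ) : ℤ :=
  ∑ p ∈ antidiagonal m, dicksonCoeff (2 * p.1 + ε) p.2 * (-1) ^ p.2 * 5 ^ p.1

lemma dicksonSum_one_succ (m : ℕ) :
    dicksonSum 1 (m + 1) = dicksonSum 0 (m + 1) - dicksonSum 1 m := by
  simp only [dicksonSum, Finset.Nat.sum_antidiagonal_succ', dicksonCoeff, add_zero,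
    add_sub_assoc, ← Finset.sum_sub_distrib]
  congr 1
  · simp [dicksonCoeff, mul_add]
  · exact Finset.sum_congr rfl fun p _ => by ring

lemma dicksonSum_zero_succ (m : ℕ) :
    dicksonSum 0 (m + 1) = 5 * dicksonSum 1 m - dicksonSum 0 m := by
  cases m with
  | zero => simp [dicksonSum, Finset.Nat.antidiagonal_succ, dicksonCoeff]
  | succ m =>
    simp only [dicksonSum]
    rw [Finset.Nat.sum_antidiagonal_succ, Finset.Nat.sum_antidiagonal_succ',
      Finset.Nat.sum_antidiagonal_succ' (n := m),
      Finset.Nat.sum_antidiagonal_succ (n := m)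
        (f := fun p => dicksonCoeff (2 * p.1 + 0) p.2 * (-1) ^ p.2 * 5 ^ p.1)]
    have h : ∑ p ∈ antidiagonal m,
          dicksonCoeff (2 * (p.1 + 1) + 0) (p.2 + 1) * (-1) ^ (p.2 + 1) * 5 ^ (p.1 + 1)
        = 5 * ∑ p ∈ antidiagonal m, dicksonCoeff (2 * p.1 + 1) (p.2 + 1) * (-1) ^ (p.2 + 1) * 5 ^ p.1
          - ∑ p ∈ antidiagonal m,
            dicksonCoeff (2 * (p.1 + 1) + 0) p.2 * (-1) ^ p.2 * 5 ^ (p.1 + 1) := by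
      rw [Finset.mul_sum, ← Finset.sum_sub_distrib]
      refine Finset.sum_congr rfl fun p _ => ?_
      rw [show 2 * (p.1 + 1) + 0 = 2 * p.1 + 1 + 1 by ring, dicksonCoeff]
      ring
    simp only [h]
    simp only [mul_zero, add_zero, mul_add, mul_one, dicksonCoeff]
    ring

lemma lucasSeq_eq (m : ℕ) : lucasSeq m = 2 * fibSeq (m + 1) - fibSeq m := by
  induction m using Nat.twoStepInduction with
  | zero => rfl
  | one => rfl
  | more m h₀ h₁ =>
    simp only [lucasSeq, fibSeq, h₀, h₁] at *
    ring

lemma dicksonSum_eq (m : ℕ) :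
    dicksonSum 0 m = lucasSeq (2 * m) ∧ dicksonSum 1 m = fibSeq (2 * m + 1) := by
  induction m with
  | zero => simp [dicksonSum, dicksonCoeff, lucasSeq, fibSeq]
  | succ m ih =>
    rw [dicksonSum_one_succ, dicksonSum_zero_succ, ih.1, ih.2, lucasSeq_eq, lucasSeq_eq]
    simp only [mul_add, mul_one, fibSeq]
    constructor <;> ring

/-- Solution of the two-parameter recursion: along a lattice path the factors depend only on how many
steps of each kind have been made. -/
lemma eq_sum_of_recursion {N d : ℤ} {b : ℕ} {G : ℕ → ℕ → ℤ} (hG0 : ∀ r, G r 0 = 1)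
    (hG : ∀ r k, r + (k + 1) ≤ b →
      G r (k + 1) = 5 * (N - r - (k + 1)) * G r k - 2 * (N - 2 * r - d) * G (r + 1) k)
    (r k : ℕ) (h : r + k ≤ b) :
    G r k = ∑ p ∈ antidiagonal k, (k.choose p.1 : ℤ) *
      ((5 ^ p.1 * ∏ l ∈ range p.1, (N - (r + k) + l)) *
        ((-2) ^ p.2 * ∏ l ∈ range p.2, (N - 2 * (r + l) - d))) := by
  induction k generalizing r with
  | zero => simp [hG0]
  | succ k ih =>
    rw [Finset.sum_antidiagonal_choose_succ_mul (fun i j =>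
      ((5 ^ i * ∏ l ∈ range i, (N - (r + ↑(k + 1)) + l)) *
        ((-2) ^ j * ∏ l ∈ range j, (N - 2 * (r + l) - d)))), hG r k h, ih r (by omega),
      ih (r + 1) (by omega), sub_eq_neg_add, Finset.mul_sum, Finset.mul_sum, ← Finset.sum_neg_distrib]
    congr 1
    · refine Finset.sum_congr rfl fun p _ => ?_
      rw [Finset.prod_range_succ' _ p.2]
      have hQ : ∏ l ∈ range p.1, (N - (((r + 1 : ℕ) : ℤ) + k) + l)
          = ∏ l ∈ range p.1, (N - ((r : ℤ) + (k + 1 : ℕ)) + l) :=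
        Finset.prod_congr rfl fun l _ => by push_cast; ring
      have hP : ∏ l ∈ range p.2, (N - 2 * (((r + 1 : ℕ) : ℤ) + l) - d)
          = ∏ l ∈ range p.2, (N - 2 * ((r : ℤ) + (l + 1 : ℕ)) - d) :=
        Finset.prod_congr rfl fun l _ => by push_cast; ring
      rw [hQ, hP]
      push_cast
      ring
    · refine Finset.sum_congr rfl fun p hp => ?_
      rw [Finset.prod_range_succ' _ p.1,
        k.choose_symm_of_eq_add (HasAntidiagonal.mem_antidiagonal.1 hp).symm]
      have hQ : ∏ l ∈ range p.1, (N - ((r : ℤ) + k) + l)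
          = ∏ l ∈ range p.1, (N - ((r : ℤ) + (k + 1 : ℕ)) + (l + 1 : ℕ)) :=
        Finset.prod_congr rfl fun l _ => by push_cast; ring
      rw [hQ]
      push_cast
      ring

lemma factorial_mul_prod_odd {ε : ℕ} (hε : ε ≤ 1) (i j : ℕ) :
    ((i + j)! : ℤ) * (2 ^ j * ∏ l ∈ range j, (2 * ((i + j : ℕ) : ℤ) - 2 * l + (2 * ε - 1)))
      * (2 * i + ε)! = i ! * (2 * (i + j) + ε)! := by
  induction j generalizing i with
  | zero => simp
  | succ j ih =>
    have h := ih (i + 1)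
    rw [show i + 1 + j = i + (j + 1) by ring] at h
    have hf : ((2 * (i + 1) + ε)! : ℤ)
        = 2 * (i + 1) * (2 * i + 1 + 2 * ε) * (2 * i + ε)! := by
      rw [show 2 * (i + 1) + ε = 2 * i + ε + 1 + 1 by ring, Nat.factorial_succ, Nat.factorial_succ]
      interval_cases ε <;> push_cast <;> ring
    rw [hf, Nat.factorial_succ i] at h
    rw [Finset.prod_range_succ]
    refine mul_left_cancel₀ (by positivity : (i + 1 : ℤ) ≠ 0) ?_
    push_cast at h ⊢
    linear_combination h

lemma prod_range_add_mul_factorial (s i : ℕ) :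
    (∏ l ∈ range i, ((s : ℤ) + 1 + l)) * s ! = (s + i)! := by
  induction i with
  | zero => simp
  | succ i ih =>
    rw [Finset.prod_range_succ, ← add_assoc, Nat.factorial_succ]
    push_cast
    linear_combination ((s : ℤ) + 1 + i) * ih

lemma choose_mul_prod_eq_dicksonCoeff_mul {ε s i j : ℕ} (hε : ε ≤ 1) (hs : i + j + ε = s + 1) :
    ((i + j).choose i : ℤ) * ((∏ l ∈ range i, ((s : ℤ) + 1 + l)) *
        (2 ^ j * ∏ l ∈ range j, (2 * ((i + j : ℕ) : ℤ) - 2 * l + (2 * ε - 1))))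
      = dicksonCoeff (2 * i + ε) j * ∏ l ∈ range (i + j), ((s : ℤ) + 1 + l) := by
  have hP := factorial_mul_prod_odd hε i j
  have hQ := prod_range_add_mul_factorial s i
  have hR := prod_range_add_mul_factorial s (i + j)
  have hD := dicksonCoeff_mul_factorial (a := 2 * i + ε) (j := j) (s := s + i) (by omega)
  have hC : (((i + j).choose i * i ! * j ! : ℕ) : ℤ) = (i + j)! := by
    rw [Nat.choose_symm_add, Nat.add_choose_mul_factorial_mul_factorial]
  have hN : ((2 * (i + j) + ε)! : ℤ) = (2 * i + ε + 2 * j) * (s + (i + j))! := by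
    rw [show 2 * (i + j) + ε = s + (i + j) + 1 by omega, Nat.factorial_succ]
    push_cast
    congr 1
    have : ((i + j + ε : ℕ) : ℤ) = (s + 1 : ℕ) := by rw [hs]
    push_cast at this
    linarith
  generalize (∏ l ∈ range j, (2 * ((i + j : ℕ) : ℤ) - 2 * l + (2 * ε - 1))) = P at *
  generalize (∏ l ∈ range i, ((s : ℤ) + 1 + l)) = Q at *
  generalize (∏ l ∈ range (i + j), ((s : ℤ) + 1 + l)) = R at *
  have hne : (i ! * j ! * (2 * i + ε)! * s ! : ℤ) ≠ 0 := by positivity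
  refine mul_left_cancel₀ hne ?_
  push_cast at hC hD
  calc _ = (((i + j).choose i : ℤ) * i ! * j !) * (2 ^ j * P) * (2 * i + ε)! * (Q * s !) := by ring
    _ = i ! * ((2 * i + ε + 2 * j) * (s + i)!) * (s + (i + j))! := by rw [hC, hP, hQ, hN]; ring
    _ = _ := by rw [← hD, ← hR]; ring

lemma prod_Icc_sub_eq {n m s : ℕ} (h : n = m + s + 1) :
    ∏ j ∈ Finset.Icc 1 m, ((n : ℤ) - j) = ∏ l ∈ range m, ((s : ℤ) + 1 + l) := by
  rw [← Finset.prod_range_reflect, ← Finset.Ico_add_one_right_eq_Icc,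
    Finset.prod_Ico_eq_prod_range]
  refine Finset.prod_congr rfl fun l hl => ?_
  rw [Finset.mem_range] at hl
  rw [h]
  push_cast [show l ≤ m - 1 by omega, show 1 ≤ m by omega]
  ring

lemma eq_dicksonSum_mul_prod {n m ε : ℕ} (hε : ε ≤ 1) (hn : 1 ≤ n) (hm : n = 2 * m + ε)
    {G : ℕ → ℕ → ℤ} (hG0 : ∀ r, G r 0 = 1)
    (hG : ∀ r k, 1 ≤ k → r + k ≤ m →
      G r k = 5 * ((n : ℤ) - r - k) * G r (k - 1)
        - 2 * ((n : ℤ) - 2 * r - ((n - 1) % 2 : ℕ)) * G (r + 1) (k - 1)) :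
    G 0 m = dicksonSum ε m * ∏ j ∈ Finset.Icc 1 m, ((n : ℤ) - j) := by
  obtain ⟨s, hs⟩ : ∃ s, m + ε = s + 1 := ⟨m + ε - 1, by omega⟩
  have hd : (((n - 1) % 2 : ℕ) : ℤ) = 1 - ε := by omega
  rw [eq_sum_of_recursion (N := n) (d := 1 - ε) (b := m) hG0
      (fun r k h => by simpa [hd] using hG r (k + 1) (by omega) h) 0 m (by omega),
    prod_Icc_sub_eq (s := s) (by omega), dicksonSum, Finset.sum_mul]
  refine Finset.sum_congr rfl fun p hp => ?_
  obtain rfl := HasAntidiagonal.mem_antidiagonal.1 hp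
  have h := choose_mul_prod_eq_dicksonCoeff_mul hε hs
  have hQ : ∏ l ∈ range p.1, ((n : ℤ) - ((0 : ℕ) + (p.1 + p.2 : ℕ)) + l)
      = ∏ l ∈ range p.1, ((s : ℤ) + 1 + l) :=
    Finset.prod_congr rfl fun l _ => by omega
  have hP : ∏ l ∈ range p.2, ((n : ℤ) - 2 * ((0 : ℕ) + l) - (1 - ε))
      = ∏ l ∈ range p.2, (2 * ((p.1 + p.2 : ℕ) : ℤ) - 2 * l + (2 * ε - 1)) :=
    Finset.prod_congr rfl fun l _ => by omega
  rw [hQ, hP, show (-2 : ℤ) ^ p.2 = (-1) ^ p.2 * 2 ^ p.2 by rw [← mul_pow]; norm_num]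
  linear_combination ((-1) ^ p.2 * 5 ^ p.1) * h

theorem omega_fibonacci_lucas_oscillating
    (n : ℕ) (hn : 1 ≤ n)
    (G : ℕ → ℕ → ℤ)
    (hG0 : ∀ r, G r 0 = 1)
    (hG : ∀ r k, 1 ≤ k → r + k ≤ n / 2 →
      G r k = 5 * ((n : ℤ) - r - k) * G r (k - 1)
        - 2 * ((n : ℤ) - 2 * r - ((n - 1) % 2 : ℕ)) * G (r + 1) (k - 1)) :
    (Odd n → G 0 (n / 2) = fibSeq n * ∏ j ∈ Finset.Icc 1 (n / 2), ((n : ℤ) - j)) ∧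
    (Even n → G 0 (n / 2) = lucasSeq n * ∏ j ∈ Finset.Icc 1 (n / 2), ((n : ℤ) - j)) := by
  constructor
  · intro h
    have hm : n = 2 * (n / 2) + 1 := (Nat.two_mul_div_two_add_one_of_odd h).symm
    rw [eq_dicksonSum_mul_prod le_rfl hn hm hG0 hG, (dicksonSum_eq _).2, ← hm]
  · intro h
    have hm : n = 2 * (n / 2) + 0 := (Nat.two_mul_div_two_of_even h).symm
    rw [eq_dicksonSum_mul_prod zero_le_one hn hm hG0 hG, (dicksonSum_eq _).1,
      Nat.two_mul_div_two_of_even h]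
end
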